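/- Let F be a field and let SF₂(F) be the group of 3×3 matrices over F of the form [[u, −v, s], [v, u, t], [0, 0, 1]] with u² + v² = 1, acting on F² by (x₁,x₂) ↦ (ux₁ − vx₂ + s, vx₁ + ux₂ + t). Define the kinematic mapping κ : SF₂(F) → FP³ by κ(g) := [2(u+1) : 2v : s(u+1) + tv : sv − t(u+1)] if u ≠ −1, and κ(g) := [0 : 2 : t : s] if u = −1 (in which case v = 0). Then for all x, y ∈ F², the image under κ of the set T_{xy} := {g ∈ SF₂(F) : g·x = y} is contained in a single projective line of FP³. -/

import Mathlib

namespace Stmt19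

attribute [local instance] Classical.propDecidable

/-- The set of matrices representing `SF₂(F)`, the positively oriented rigid motions:
`[[u, -v, s], [v, u, t], [0, 0, 1]]` with `u² + v² = 1`. -/
def SF2Set (F : Type) [Field F] : Set (Matrix (Fin 3) (Fin 3) F) :=
  {m | ∃ u v s t : F, u ^ 2 + v ^ 2 = 1 ∧ m = !![u, -v, s; v, u, t; 0, 0, 1]}

/-- The affine action of such a matrix on the plane:
`(x₁, x₂) ↦ (u·x₁ - v·x₂ + s, v·x₁ + u·x₂ + t)`. -/
def act {F : Type} [Field F] (m : Matrix (Fin 3) (Fin 3) F) (x : F × F) : F × F :=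
  (m 0 0 * x.1 + m 0 1 * x.2 + m 0 2, m 1 0 * x.1 + m 1 1 * x.2 + m 1 2)

/-- A default point of `FP³`, used only to totalise the kinematic mapping. -/
noncomputable def defaultPt (F : Type) [Field F] : Projectivization F (Fin 4 → F) :=
  Projectivization.mk F ![1, 0, 0, 0] (by
    intro h
    have h0 := congrFun h 0
    simp at h0)

/-- The Blaschke–Grünwald kinematic mapping: for `g` with entries `u = m₀₀`, `v = m₁₀`,
`s = m₀₂`, `t = m₁₂`, `κ(g) = [2(u+1) : 2v : s(u+1) + tv : sv - t(u+1)]` if `u ≠ -1`,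
and `κ(g) = [0 : 2 : t : s]` if `u = -1`. (When `2 ≠ 0` in `F`, the indicated homogeneous
vectors are non-zero and the junk branches are never taken.) -/
noncomputable def kappa {F : Type} [Field F] (m : Matrix (Fin 3) (Fin 3) F) :
    Projectivization F (Fin 4 → F) :=
  if m 0 0 ≠ -1 then
    if h : (![2 * (m 0 0 + 1), 2 * m 1 0,
              m 0 2 * (m 0 0 + 1) + m 1 2 * m 1 0,
              m 0 2 * m 1 0 - m 1 2 * (m 0 0 + 1)] : Fin 4 → F) ≠ 0 then
      Projectivization.mk F _ h
    else defaultPt F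
  else
    if h : (![0, 2, m 1 2, m 0 2] : Fin 4 → F) ≠ 0 then
      Projectivization.mk F _ h
    else defaultPt F

/-- The line of `FP³` through `[2 : 0 : y₁ - x₁ : x₂ - y₂]` and `[0 : 2 : x₂ + y₂ : x₁ + y₁]`,
as a subspace of `F⁴`. -/
def transporterLine {F : Type} [Field F] (x y : F × F) : Submodule F (Fin 4 → F) :=
  Submodule.span F (Set.range
    ![![2, 0, y.1 - x.1, x.2 - y.2], ![0, 2, x.2 + y.2, x.1 + y.1]])

theorem finrank_transporterLine {F : Type} [Field F] (h2 : (2 : F) ≠ 0) (x y : F × F) :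
    Module.finrank F (transporterLine x y) = 2 := by
  refine (finrank_span_eq_card ?_).trans (Fintype.card_fin 2)
  rw [LinearIndependent.pair_iff]
  intro a b h
  have h0 := congrFun h 0
  have h1 := congrFun h 1
  simp_all

theorem mem_transporterLine {F : Type} [Field F] {x y : F × F} (a b : F) {p : Fin 4 → F}
    (hp : p = ![2 * a, 2 * b, (y.1 - x.1) * a + (x.2 + y.2) * b,
      (x.2 - y.2) * a + (x.1 + y.1) * b]) :
    p ∈ transporterLine x y := by
  rw [transporterLine, Matrix.range_cons_cons_empty, Submodule.mem_span_pair]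
  refine ⟨a, b, ?_⟩
  rw [hp]
  ext i
  fin_cases i <;> simp <;> ring

/-- For all `x, y ∈ F²`, the image under the kinematic mapping `κ` of the set
`T_{xy} = {g ∈ SF₂(F) : g·x = y}` is contained in a single projective line of `FP³`. -/
theorem kappa_transporter_in_line (F : Type) [Field F] (h2 : (2 : F) ≠ 0) (x y : F × F) :
    ∃ W : Submodule F (Fin 4 → F), Module.finrank F W = 2 ∧
      ∀ m : Matrix (Fin 3) (Fin 3) F, m ∈ SF2Set F → act m x = y →
        (kappa m).submodule ≤ W := by
  refine ⟨transporterLine x y, finrank_transporterLine h2 x y, ?_⟩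
  rintro _ ⟨u, v, s, t, huv, rfl⟩ rfl
  by_cases hu : u = -1
  · obtain rfl : v = 0 := by
      subst hu
      simpa using huv
    have hne : (![0, 2, t, s] : Fin 4 → F) ≠ 0 := fun h => h2 (congrFun h 1)
    have hk : kappa !![u, -0, s; 0, u, t; 0, 0, 1] = Projectivization.mk F _ hne :=
      (if_neg (not_not_intro hu)).trans (dif_pos hne)
    rw [hk, Projectivization.submodule_mk, Submodule.span_singleton_le_iff_mem]
    apply mem_transporterLine 0 1
    simp [act, hu]
  · have hne : (![2 * (u + 1), 2 * v, s * (u + 1) + t * v, s * v - t * (u + 1)] : Fin 4 → F) ≠ 0 :=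
      fun h => mul_ne_zero h2 (fun h' => hu (eq_neg_of_add_eq_zero_left h')) (congrFun h 0)
    have hk : kappa !![u, -v, s; v, u, t; 0, 0, 1] = Projectivization.mk F _ hne :=
      (if_pos hu).trans (dif_pos hne)
    rw [hk, Projectivization.submodule_mk, Submodule.span_singleton_le_iff_mem]
    apply mem_transporterLine (u + 1) v
    ext i
    fin_cases i <;> simp [act]
    · linear_combination (-x.1) * huv
    · linear_combination x.2 * huv

end Stmt19
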